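/- arXiv:1005.2913 — 9 statements merged into one kernel-verified Lean document; each statement's English description precedes it below -/
import Mathlib

section
/- Let Y be a real n×m matrix and b a vector in ℝ^n. Suppose p ∈ ℝ^m satisfies Y·p = b and p has the maximal number of nonzero coordinates among all solutions of Y·x = b (i.e., for every q with Y·q = b, the number of indices i with q i ≠ 0 is at most the number of indices i with p i ≠ 0). Then for every q ∈ ℝ^m with Y·q = b, the support of q is contained in the support of p; that is, q i ≠ 0 implies p i ≠ 0 for all i. -/
/-- If `p` solves `Y·x = b` with the maximal number of nonzero
coordinates among all solutions, then the support of every solution `q` is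
contained in the support of `p`. -/
theorem dense_solution_support_superset
    {n m : ℕ} (Y : Matrix (Fin n) (Fin m) ℝ) (b : Fin n → ℝ)
    (p : Fin m → ℝ) (hp : Y.mulVec p = b)
    (hmax : ∀ q : Fin m → ℝ, Y.mulVec q = b →
      {i | q i ≠ 0}.ncard ≤ {i | p i ≠ 0}.ncard) :
    ∀ q : Fin m → ℝ, Y.mulVec q = b → ∀ i : Fin m, q i ≠ 0 → p i ≠ 0 := by
  intro q hq i hqi hpi
  obtain ⟨t, ht⟩ := Set.Infinite.exists_notMem_finset (Set.infinite_univ (α := ℝ))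
    (insert 0 (Finset.univ.image fun j => p j / (p j - q j)))
  have ht := ht.2
  simp only [Finset.mem_insert, Finset.mem_image, Finset.mem_univ, true_and, not_or,
    not_exists] at ht
  obtain ⟨ht0, ht⟩ := ht
  have h := hmax (p + t • (q - p)) (by
    rw [Matrix.mulVec_add, Matrix.mulVec_smul, Matrix.mulVec_sub, hp, hq]; simp)
  refine absurd h (not_le.mpr (Set.ncard_lt_ncard ?_ (Set.toFinite _)))
  refine (Set.ssubset_iff_of_subset ?_).mpr ⟨i, ?_, ?_⟩
  · intro j hj h0
    have hj : p j ≠ 0 := hj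
    simp only [Pi.add_apply, Pi.smul_apply, Pi.sub_apply, smul_eq_mul] at h0
    have hne : p j - q j ≠ 0 := by
      intro h1
      have h2 : q j - p j = 0 := by linarith
      rw [h2] at h0
      apply hj
      linarith
    apply ht j
    rw [div_eq_iff hne]
    linarith
  · simp [hpi, ht0, hqi]
  · simp [hpi]
end

section
/- Let Y be a real n×m matrix and b a vector in ℝ^n. If p and p' both satisfy Y·p = b and Y·p' = b, and each of p and p' has the maximal number of nonzero coordinates among all solutions of Y·x = b, then p and p' have exactly the same support: for every index i, p i ≠ 0 if and only if p' i ≠ 0. -/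
/-- Any two solutions of `Y·x = b` that both have the maximal
number of nonzero coordinates among all solutions have exactly the same
support. -/
theorem dense_solution_support_unique
    {n m : ℕ} (Y : Matrix (Fin n) (Fin m) ℝ) (b : Fin n → ℝ)
    (p p' : Fin m → ℝ) (hp : Y.mulVec p = b) (hp' : Y.mulVec p' = b)
    (hmax : ∀ q : Fin m → ℝ, Y.mulVec q = b →
      {i | q i ≠ 0}.ncard ≤ {i | p i ≠ 0}.ncard)
    (hmax' : ∀ q : Fin m → ℝ, Y.mulVec q = b →
      {i | q i ≠ 0}.ncard ≤ {i | p' i ≠ 0}.ncard) :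
    ∀ i : Fin m, p i ≠ 0 ↔ p' i ≠ 0 := by
  obtain ⟨t, ht⟩ := (Set.finite_range (fun i : Fin m => p i / (p i - p' i))).infinite_compl.nonempty
  have hq : Y.mulVec (p + t • (p' - p)) = b := by
    rw [Matrix.mulVec_add, Matrix.mulVec_smul, Matrix.mulVec_sub, hp, hp']
    simp
  have key : ∀ i, p i + t * (p' i - p i) = 0 → p i = 0 ∧ p' i = 0 := by
    intro i hi
    by_cases h : p i - p' i = 0
    · have h2 : p' i = p i := by linarith
      rw [h2] at hi ⊢
      simp at hi
      exact ⟨hi, hi⟩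
    · exfalso
      apply ht
      refine ⟨i, ?_⟩
      show p i / (p i - p' i) = t
      rw [div_eq_iff h]
      linarith
  have e1 : {i | p i ≠ 0} = {i | (p + t • (p' - p)) i ≠ 0} :=
    Set.eq_of_subset_of_ncard_le (fun i hi h => hi (key i (by simpa using h)).1)
      (hmax _ hq) (Set.toFinite _)
  have e2 : {i | p' i ≠ 0} = {i | (p + t • (p' - p)) i ≠ 0} :=
    Set.eq_of_subset_of_ncard_le (fun i hi h => hi (key i (by simpa using h)).2)
      (hmax' _ hq) (Set.toFinite _)
  intro i
  exact Set.ext_iff.mp (e1.trans e2.symm) i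
end

section
/- Let p and q be vectors in ℝ^m. Then there exists a real number λ with 0 < λ < 1 such that the support of (1−λ)·p + λ·q equals the union of the support of p and the support of q. -/
/-- For vectors `p q : ℝ^m` there is `0 < λ < 1` such that the
support of `(1−λ)·p + λ·q` is the union of the supports of `p` and `q`. -/
theorem exists_convex_combination_support_union
    {m : ℕ} (p q : Fin m → ℝ) :
    ∃ l : ℝ, 0 < l ∧ l < 1 ∧
      {i : Fin m | ((1 - l) • p + l • q) i ≠ 0} =
        {i : Fin m | p i ≠ 0} ∪ {i : Fin m | q i ≠ 0} := by
  obtain ⟨l, ⟨h0, h1⟩, hl⟩ := (Set.Ioo_infinite (zero_lt_one (α := ℝ))).exists_notMem_finite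
    (Set.finite_range fun i => p i / (p i - q i))
  refine ⟨l, h0, h1, ?_⟩
  ext i
  simp only [Set.mem_setOf_eq, Set.mem_union, Pi.add_apply, Pi.smul_apply, smul_eq_mul]
  constructor
  · intro h
    by_contra hc
    push Not at hc
    apply h
    rw [hc.1, hc.2]
    ring
  · intro h e
    by_cases hpq : p i - q i = 0
    · have hq : q i = p i := by linarith
      rw [hq] at e h
      have hp : p i = 0 := by linarith
      simp [hp] at h
    · apply hl
      refine ⟨i, ?_⟩
      show p i / (p i - q i) = l
      rw [div_eq_iff hpq]
      linarith
end

section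
/- Let Y be a real n×m matrix and b ∈ ℝ^n. Suppose p and q both satisfy Y·x = b, and there exists an index i with q i ≠ 0 but p i = 0. Then there exists r ∈ ℝ^m with Y·r = b such that the number of nonzero coordinates of r is strictly greater than the number of nonzero coordinates of p. -/
/-- If `p` and `q` solve `Y·x = b` and `q` is nonzero at an index
where `p` vanishes, then some solution `r` has strictly more nonzero
coordinates than `p`. -/
theorem exists_solution_more_nonzeros
    {n m : ℕ} (Y : Matrix (Fin n) (Fin m) ℝ) (b : Fin n → ℝ)
    (p q : Fin m → ℝ) (hp : Y.mulVec p = b) (hq : Y.mulVec q = b)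
    (i : Fin m) (hqi : q i ≠ 0) (hpi : p i = 0) :
    ∃ r : Fin m → ℝ, Y.mulVec r = b ∧
      {j | p j ≠ 0}.ncard < {j | r j ≠ 0}.ncard := by
  obtain ⟨t, ht⟩ := ((Set.finite_range (fun j => p j / (p j - q j))).insert 0).exists_notMem
  simp only [Set.mem_insert_iff, Set.mem_range, not_or, not_exists] at ht
  obtain ⟨ht0, ht⟩ := ht
  refine ⟨p + t • (q - p), ?_, ?_⟩
  · rw [Matrix.mulVec_add, Matrix.mulVec_smul, Matrix.mulVec_sub, hp, hq]
    simp
  · apply Set.ncard_lt_ncard _ (Set.toFinite _)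
    refine (Set.ssubset_iff_of_subset ?_).2 ⟨i, ?_, ?_⟩
    · intro j hj h
      simp only [Set.mem_setOf_eq, Pi.add_apply, Pi.smul_apply, Pi.sub_apply, smul_eq_mul] at hj h
      have hne : p j - q j ≠ 0 := by
        intro h0
        apply hj
        linear_combination h + t * h0
      apply ht j
      rw [div_eq_iff hne]
      linear_combination h
    · simp [hpi, ht0, hqi]
    · simp [hpi]
end

section
/- Fix real matrices Y (n×m) and M (n×m), and let S be the set of m×m Kirchhoff matrices A with Y·A = M. Suppose A_d ∈ S maximizes, among all elements of S, the number of pairs (i,j) with i ≠ j and A i j ≠ 0. Then for every A ∈ S and every pair (i,j) with i ≠ j, if A i j ≠ 0 then A_d i j ≠ 0. -/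
/-- An `m×m` real matrix is a Kirchhoff matrix if each column sums to zero,
every off-diagonal entry is nonnegative and every diagonal entry is
nonpositive. -/
def IsKirchhoff {m : ℕ} (A : Matrix (Fin m) (Fin m) ℝ) : Prop :=
  (∀ j, ∑ i, A i j = 0) ∧ (∀ i j, i ≠ j → 0 ≤ A i j) ∧ (∀ i, A i i ≤ 0)

/-- Theorem 1 of the paper: the unweighted directed graph of any
realization is a subgraph of that of a dense realization. -/
theorem dense_realization_superstructure
    {n m : ℕ} (Y M : Matrix (Fin n) (Fin m) ℝ)
    (S : Set (Matrix (Fin m) (Fin m) ℝ))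
    (hS : S = {A | IsKirchhoff A ∧ Y * A = M})
    (A_d : Matrix (Fin m) (Fin m) ℝ) (hA_d : A_d ∈ S)
    (hmax : ∀ A ∈ S,
      {ij : Fin m × Fin m | ij.1 ≠ ij.2 ∧ A ij.1 ij.2 ≠ 0}.ncard ≤
      {ij : Fin m × Fin m | ij.1 ≠ ij.2 ∧ A_d ij.1 ij.2 ≠ 0}.ncard) :
    ∀ A ∈ S, ∀ i j : Fin m, i ≠ j → A i j ≠ 0 → A_d i j ≠ 0 := by
  subst hS
  intro A hA i j hij hAij hd
  obtain ⟨⟨a1, a2, a3⟩, a4⟩ := hA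
  obtain ⟨⟨d1, d2, d3⟩, d4⟩ := hA_d
  have hB := hmax ((1/2 : ℝ) • A + (1/2 : ℝ) • A_d) ?_
  · refine absurd hB (not_le.mpr (Set.ncard_lt_ncard ?_ (Set.toFinite _)))
    rw [Set.ssubset_iff_of_subset]
    · refine ⟨(i, j), ⟨hij, ?_⟩, fun h => h.2 hd⟩
      simp [hd, hAij]
    · rintro ⟨k, l⟩ ⟨hkl, h⟩
      refine ⟨hkl, ?_⟩
      have h1 := a2 k l hkl
      have h2 := lt_of_le_of_ne (d2 k l hkl) (Ne.symm h)
      simp only [Matrix.add_apply, Matrix.smul_apply, smul_eq_mul]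
      intro h3
      linarith
  · refine ⟨⟨fun l => ?_, fun k l hkl => ?_, fun k => ?_⟩, ?_⟩
    · simp only [Matrix.add_apply, Matrix.smul_apply, smul_eq_mul]
      rw [Finset.sum_add_distrib, ← Finset.mul_sum, ← Finset.mul_sum, a1, d1]
      norm_num
    · have h1 := a2 k l hkl
      have h2 := d2 k l hkl
      simp only [Matrix.add_apply, Matrix.smul_apply, smul_eq_mul]
      linarith
    · have h1 := a3 k
      have h2 := d3 k
      simp only [Matrix.add_apply, Matrix.smul_apply, smul_eq_mul]
      linarith
    · rw [Matrix.mul_add, Matrix.mul_smul, Matrix.mul_smul, a4, d4, ← add_smul]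
      norm_num
end

section
/- Fix real matrices Y (n×m) and M (n×m), and let S be the set of m×m Kirchhoff matrices A with Y·A = M. If A_d and A_d' both belong to S and both maximize, among all elements of S, the number of pairs (i,j) with i ≠ j and A i j ≠ 0, then for every pair (i,j) with i ≠ j, A_d i j ≠ 0 if and only if A_d' i j ≠ 0. -/
/-- Theorem 2 of the paper: the directed graph structure of the
dense realization is unique. -/
theorem dense_realization_structure_unique
    {n m : ℕ} (Y M : Matrix (Fin n) (Fin m) ℝ)
    (S : Set (Matrix (Fin m) (Fin m) ℝ))
    (hS : S = {A | IsKirchhoff A ∧ Y * A = M})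
    (A_d A_d' : Matrix (Fin m) (Fin m) ℝ)
    (hA_d : A_d ∈ S) (hA_d' : A_d' ∈ S)
    (hmax : ∀ A ∈ S,
      {ij : Fin m × Fin m | ij.1 ≠ ij.2 ∧ A ij.1 ij.2 ≠ 0}.ncard ≤
      {ij : Fin m × Fin m | ij.1 ≠ ij.2 ∧ A_d ij.1 ij.2 ≠ 0}.ncard)
    (hmax' : ∀ A ∈ S,
      {ij : Fin m × Fin m | ij.1 ≠ ij.2 ∧ A ij.1 ij.2 ≠ 0}.ncard ≤
      {ij : Fin m × Fin m | ij.1 ≠ ij.2 ∧ A_d' ij.1 ij.2 ≠ 0}.ncard) :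
    ∀ i j : Fin m, i ≠ j → (A_d i j ≠ 0 ↔ A_d' i j ≠ 0) := by
  subst hS
  obtain ⟨⟨h1, h2, h3⟩, h4⟩ := hA_d
  obtain ⟨⟨k1, k2, k3⟩, k4⟩ := hA_d'
  have hmem : ((1/2 : ℝ) • (A_d + A_d')) ∈ {A | IsKirchhoff A ∧ Y * A = M} := by
    refine ⟨⟨fun j => ?_, fun i j hij => ?_, fun i => ?_⟩, ?_⟩
    · simp only [Matrix.smul_apply, Matrix.add_apply, smul_eq_mul]
      rw [← Finset.mul_sum, Finset.sum_add_distrib, h1, k1]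
      norm_num
    · simp only [Matrix.smul_apply, Matrix.add_apply, smul_eq_mul]
      have := h2 i j hij
      have := k2 i j hij
      linarith
    · simp only [Matrix.smul_apply, Matrix.add_apply, smul_eq_mul]
      have := h3 i
      have := k3 i
      linarith
    · rw [Matrix.mul_smul, Matrix.mul_add, h4, k4]
      ext i j
      simp only [Matrix.smul_apply, Matrix.add_apply, smul_eq_mul]
      ring
  have key : ∀ i j, i ≠ j → (((1/2 : ℝ) • (A_d + A_d')) i j ≠ 0 ↔ A_d i j ≠ 0 ∨ A_d' i j ≠ 0) := by
    intro i j hij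
    simp only [Matrix.smul_apply, Matrix.add_apply, smul_eq_mul]
    have a := h2 i j hij
    have b := k2 i j hij
    constructor
    · intro h
      by_contra! hc
      apply h
      rw [hc.1, hc.2]
      norm_num
    · rintro (h | h) h0
      · apply h
        linarith
      · apply h
        linarith
  have e1 := Set.eq_of_subset_of_ncard_le
    (fun (ij : Fin m × Fin m) (h : ij ∈ {ij : Fin m × Fin m | ij.1 ≠ ij.2 ∧ A_d ij.1 ij.2 ≠ 0}) =>
      (⟨h.1, (key _ _ h.1).2 (Or.inl h.2)⟩ :
        ij ∈ {ij : Fin m × Fin m | ij.1 ≠ ij.2 ∧ ((1/2 : ℝ) • (A_d + A_d')) ij.1 ij.2 ≠ 0}))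
    (hmax _ hmem) (Set.toFinite _)
  have e2 := Set.eq_of_subset_of_ncard_le
    (fun (ij : Fin m × Fin m) (h : ij ∈ {ij : Fin m × Fin m | ij.1 ≠ ij.2 ∧ A_d' ij.1 ij.2 ≠ 0}) =>
      (⟨h.1, (key _ _ h.1).2 (Or.inr h.2)⟩ :
        ij ∈ {ij : Fin m × Fin m | ij.1 ≠ ij.2 ∧ ((1/2 : ℝ) • (A_d + A_d')) ij.1 ij.2 ≠ 0}))
    (hmax' _ hmem) (Set.toFinite _)
  intro i j hij
  have e := Set.ext_iff.1 (e1.trans e2.symm) (i, j)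
  exact ⟨fun h => (e.1 ⟨hij, h⟩).2, fun h => (e.2 ⟨hij, h⟩).2⟩
end

section
/- Fix real matrices Y (n×m) and M (n×m), and let S be the set of m×m Kirchhoff matrices A with Y·A = M. If S is nonempty, then there exists A_d ∈ S such that for every A ∈ S and every pair (i,j) with i ≠ j, A i j ≠ 0 implies A_d i j ≠ 0. -/
/-- Remark R1 of the paper: if the set of realizations is
nonempty then it contains a dense realization whose reaction set contains the
reaction set of every realization. -/
theorem dense_realization_exists
    {n m : ℕ} (Y M : Matrix (Fin n) (Fin m) ℝ)
    (S : Set (Matrix (Fin m) (Fin m) ℝ))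
    (hS : S = {A | IsKirchhoff A ∧ Y * A = M})
    (hne : S.Nonempty) :
    ∃ A_d ∈ S, ∀ A ∈ S, ∀ i j : Fin m, i ≠ j → A i j ≠ 0 → A_d i j ≠ 0 := by
  classical
  have key : ∀ T : Finset (Fin m × Fin m), ∃ B ∈ S, ∀ p ∈ T, p.1 ≠ p.2 →
      ∀ A ∈ S, A p.1 p.2 ≠ 0 → B p.1 p.2 ≠ 0 := by
    intro T
    induction T using Finset.induction_on with
    | empty =>
      obtain ⟨B, hB⟩ := hne
      exact ⟨B, hB, by simp⟩
    | insert q T hq ih =>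
      obtain ⟨B, hB, hT⟩ := ih
      by_cases h : ∃ C ∈ S, C q.1 q.2 ≠ 0
      · obtain ⟨C, hC, hCq⟩ := h
        have hB' := hB
        have hC' := hC
        rw [hS] at hB' hC'
        obtain ⟨⟨b1, b2, b3⟩, b4⟩ := hB'
        obtain ⟨⟨c1, c2, c3⟩, c4⟩ := hC'
        refine ⟨(1/2 : ℝ) • B + (1/2 : ℝ) • C, ?_, ?_⟩
        · rw [hS]
          refine ⟨⟨?_, ?_, ?_⟩, ?_⟩
          · intro j
            simp [Finset.sum_add_distrib, ← Finset.mul_sum, b1, c1]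
          · intro i j hij
            have := b2 i j hij
            have := c2 i j hij
            simp only [Matrix.add_apply, Matrix.smul_apply, smul_eq_mul]
            linarith
          · intro i
            have := b3 i
            have := c3 i
            simp only [Matrix.add_apply, Matrix.smul_apply, smul_eq_mul]
            linarith
          · rw [Matrix.mul_add, Matrix.mul_smul, Matrix.mul_smul, b4, c4, ← add_smul]
            norm_num
        · intro p hp hne' A hA hAp
          have h1 := b2 _ _ hne'
          have h2 := c2 _ _ hne'
          simp only [Matrix.add_apply, Matrix.smul_apply, smul_eq_mul]
          rcases Finset.mem_insert.1 hp with rfl | hp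
          · have := lt_of_le_of_ne h2 (Ne.symm hCq)
            intro h0
            linarith
          · have := lt_of_le_of_ne h1 (Ne.symm (hT p hp hne' A hA hAp))
            intro h0
            linarith
      · refine ⟨B, hB, ?_⟩
        intro p hp hne' A hA hAp
        rcases Finset.mem_insert.1 hp with rfl | hp
        · exact absurd ⟨A, hA, hAp⟩ h
        · exact hT p hp hne' A hA hAp
  obtain ⟨B, hB, h⟩ := key Finset.univ
  exact ⟨B, hB, fun A hA i j hij hA0 => h (i, j) (Finset.mem_univ _) hij A hA hA0⟩
end

section
/- Fix real matrices Y (n×m) and M (n×m), and let S be the set of m×m Kirchhoff matrices A with Y·A = M. If A and A' both belong to S, then there exists A'' ∈ S such that for every pair (i,j) with i ≠ j, if A i j ≠ 0 or A' i j ≠ 0 then A'' i j ≠ 0. -/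
/-- the set of realizations is closed under taking unions of
reaction sets: for any two realizations there is a realization whose nonzero
off-diagonal pattern contains the union of theirs. -/
theorem realization_union_closure
    {n m : ℕ} (Y M : Matrix (Fin n) (Fin m) ℝ)
    (S : Set (Matrix (Fin m) (Fin m) ℝ))
    (hS : S = {B | IsKirchhoff B ∧ Y * B = M})
    (A A' : Matrix (Fin m) (Fin m) ℝ) (hA : A ∈ S) (hA' : A' ∈ S) :
    ∃ A'' ∈ S, ∀ i j : Fin m, i ≠ j →
      (A i j ≠ 0 ∨ A' i j ≠ 0) → A'' i j ≠ 0 := by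
  subst hS
  obtain ⟨⟨hc, ho, hd⟩, hY⟩ := hA
  obtain ⟨⟨hc', ho', hd'⟩, hY'⟩ := hA'
  have e : ∀ i j, ((1/2 : ℝ) • A + (1/2 : ℝ) • A') i j = 1/2 * A i j + 1/2 * A' i j := by
    intro i j
    simp [Matrix.add_apply, Matrix.smul_apply]
  refine ⟨(1/2 : ℝ) • A + (1/2 : ℝ) • A', ⟨⟨?_, ?_, ?_⟩, ?_⟩, ?_⟩
  · intro j
    simp only [e]
    rw [Finset.sum_add_distrib, ← Finset.mul_sum, ← Finset.mul_sum, hc, hc']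
    norm_num
  · intro i j h
    rw [e]
    linarith [ho i j h, ho' i j h]
  · intro i
    rw [e]
    linarith [hd i, hd' i]
  · rw [Matrix.mul_add, Matrix.mul_smul, Matrix.mul_smul, hY, hY', ← add_smul]
    norm_num
  · intro i j h hne h0
    rw [e] at h0
    have h1 := ho i j h
    have h2 := ho' i j h
    rcases hne with hn | hn
    · exact hn (by linarith)
    · exact hn (by linarith)
end

section
/- Fix real matrices Y (n×m) and M (n×m), and let S be the set of m×m Kirchhoff matrices A with Y·A = M. Suppose A_s ∈ S minimizes and A_d ∈ S maximizes, among all elements of S, the number of pairs (i,j) with i ≠ j and A i j ≠ 0, and suppose these minimal and maximal counts are equal. Then every A ∈ S satisfies: for every pair (i,j) with i ≠ j, A i j ≠ 0 if and only if A_d i j ≠ 0. -/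
/-- Remark R3 of the paper: if the sparse and dense realizations
have the same number of reactions, then every realization has the same graph
structure as the dense realization. -/
theorem sparse_eq_dense_implies_unique_structure
    {n m : ℕ} (Y M : Matrix (Fin n) (Fin m) ℝ)
    (S : Set (Matrix (Fin m) (Fin m) ℝ))
    (hS : S = {A | IsKirchhoff A ∧ Y * A = M})
    (A_s A_d : Matrix (Fin m) (Fin m) ℝ)
    (hA_s : A_s ∈ S) (hA_d : A_d ∈ S)
    (hmin : ∀ A ∈ S,
      {ij : Fin m × Fin m | ij.1 ≠ ij.2 ∧ A_s ij.1 ij.2 ≠ 0}.ncard ≤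
      {ij : Fin m × Fin m | ij.1 ≠ ij.2 ∧ A ij.1 ij.2 ≠ 0}.ncard)
    (hmax : ∀ A ∈ S,
      {ij : Fin m × Fin m | ij.1 ≠ ij.2 ∧ A ij.1 ij.2 ≠ 0}.ncard ≤
      {ij : Fin m × Fin m | ij.1 ≠ ij.2 ∧ A_d ij.1 ij.2 ≠ 0}.ncard)
    (heq : {ij : Fin m × Fin m | ij.1 ≠ ij.2 ∧ A_s ij.1 ij.2 ≠ 0}.ncard =
           {ij : Fin m × Fin m | ij.1 ≠ ij.2 ∧ A_d ij.1 ij.2 ≠ 0}.ncard) :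
    ∀ A ∈ S, ∀ i j : Fin m, i ≠ j → (A i j ≠ 0 ↔ A_d i j ≠ 0) := by
  intro A hA
  have hB : (1/2 : ℝ) • (A + A_d) ∈ S := by
    rw [hS] at hA hA_d ⊢
    obtain ⟨⟨a1, a2, a3⟩, a4⟩ := hA
    obtain ⟨⟨d1, d2, d3⟩, d4⟩ := hA_d
    refine ⟨⟨fun j => ?_, fun i j hij => ?_, fun i => ?_⟩, ?_⟩
    · simp only [Matrix.smul_apply, Matrix.add_apply, smul_eq_mul]
      rw [← Finset.mul_sum, Finset.sum_add_distrib, a1, d1]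
      norm_num
    · simp only [Matrix.smul_apply, Matrix.add_apply, smul_eq_mul]
      linarith [a2 i j hij, d2 i j hij]
    · simp only [Matrix.smul_apply, Matrix.add_apply, smul_eq_mul]
      linarith [a3 i, d3 i]
    · rw [Matrix.mul_smul, Matrix.mul_add, a4, d4]
      ext i j
      simp only [Matrix.smul_apply, Matrix.add_apply, smul_eq_mul]
      ring
  have nA : ∀ i j, i ≠ j → 0 ≤ A i j := by
    rw [hS] at hA
    exact hA.1.2.1
  have nD : ∀ i j, i ≠ j → 0 ≤ A_d i j := by
    rw [hS] at hA_d
    exact hA_d.1.2.1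
  have h1 : {ij : Fin m × Fin m | ij.1 ≠ ij.2 ∧ A_d ij.1 ij.2 ≠ 0} =
      {ij : Fin m × Fin m | ij.1 ≠ ij.2 ∧ ((1/2 : ℝ) • (A + A_d)) ij.1 ij.2 ≠ 0} := by
    refine Set.eq_of_subset_of_ncard_le ?_ (hmax _ hB) (Set.toFinite _)
    rintro ⟨i, j⟩ ⟨hij, h⟩
    refine ⟨hij, fun h0 => h ?_⟩
    simp only [Matrix.smul_apply, Matrix.add_apply, smul_eq_mul] at h0 ⊢
    linarith [nA i j hij, nD i j hij]
  have h2 : {ij : Fin m × Fin m | ij.1 ≠ ij.2 ∧ A ij.1 ij.2 ≠ 0} =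
      {ij : Fin m × Fin m | ij.1 ≠ ij.2 ∧ A_d ij.1 ij.2 ≠ 0} := by
    refine Set.eq_of_subset_of_ncard_le ?_ (heq ▸ hmin A hA) (Set.toFinite _)
    rw [h1]
    rintro ⟨i, j⟩ ⟨hij, h⟩
    refine ⟨hij, fun h0 => h ?_⟩
    simp only [Matrix.smul_apply, Matrix.add_apply, smul_eq_mul] at h0 ⊢
    linarith [nA i j hij, nD i j hij]
  intro i j hij
  have h3 := Set.ext_iff.mp h2 (i, j)
  simp only [Set.mem_setOf_eq] at h3
  exact ⟨fun h => (h3.mp ⟨hij, h⟩).2, fun h => (h3.mpr ⟨hij, h⟩).2⟩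
end
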